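/- arXiv:1701.03058 — 2 statements merged into one kernel-verified Lean document; each statement's English description precedes it below -/
import Mathlib

section
/- For every fixed h with k ≤ h ≤ n-l and every i with k+l+2 ≤ i ≤ n, the connection coefficients satisfy the three-term recurrence c_{ih} = K_h(i) c_{i-1,h} + L(i) c_{i-2,h}, where M(i) := (i-k-l-1)(n+i+α+β)(i+k+β-l-1)(2i+α+β) / [(2i+α+β-2)(i+k+l+α+β)(i+l+α-k)(i-n-1)], K_h(i) := ((α+l+i-k)/(i-k-l)) · [1 - M(i) - (l+h-n)(2i+α+β-1)_2 / ((i+k+l+α+β)(α+l+i-k)(i-n-1))], and L(i) := ((α+l+i-k-1)_2/((i-k-l-1)_2)) · M(i). (Recurrence of Theorem 3.3, computing c_{ih} for increasing i.) -/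
open Finset

/-- Pochhammer symbol `(x)_m = x (x+1) ⋯ (x+m-1)`. -/
noncomputable def poch (x : ℝ) (m : ℕ) : ℝ := ∏ j ∈ Finset.range m, (x + j)

/-- Bernstein polynomial `B_j^n(x) = C(n,j) x^j (1-x)^(n-j)`. -/
noncomputable def bern (n j : ℕ) (x : ℝ) : ℝ := (n.choose j : ℝ) * x ^ j * (1 - x) ^ (n - j)

/-- Shifted Jacobi polynomial `R_i^(a,b)(x)`. -/
noncomputable def shiftedJacobi (a b : ℝ) (i : ℕ) (x : ℝ) : ℝ :=
  poch (a + 1) i / (Nat.factorial i : ℝ) *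
    ∑ j ∈ Finset.range (i + 1),
      poch (-(i : ℝ)) j * poch ((i : ℝ) + a + b + 1) j /
        ((Nat.factorial j : ℝ) * poch (a + 1) j) * (1 - x) ^ j

/-- Hahn polynomial `Q_m(t; a, b, N)`. -/
noncomputable def hahnQ (m : ℕ) (t : ℝ) (a b : ℝ) (N : ℕ) : ℝ :=
  ∑ j ∈ Finset.range (m + 1),
    poch (-(m : ℝ)) j * poch ((m : ℝ) + a + b + 1) j * poch (-t) j /
      ((Nat.factorial j : ℝ) * poch (a + 1) j * poch (-(N : ℝ)) j)

/-- Dual Hahn polynomial `R_m(λ(t); a, b, N)` with `λ(t) = t(t+a+b+1)`. -/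
noncomputable def dualHahnR (m : ℕ) (t : ℝ) (a b : ℝ) (N : ℕ) : ℝ :=
  ∑ j ∈ Finset.range (m + 1),
    poch (-(m : ℝ)) j * poch (t + a + b + 1) j * poch (-t) j /
      ((Nat.factorial j : ℝ) * poch (a + 1) j * poch (-(N : ℝ)) j)

/-- Modified Jacobi polynomial `J_{i,k,l}^(α,β)(x) = (1-x)^l x^k R_{i-k-l}^(α+2l,β+2k)(x)`. -/
noncomputable def modJacobi (α β : ℝ) (k l i : ℕ) (x : ℝ) : ℝ :=
  (1 - x) ^ l * x ^ k * shiftedJacobi (α + 2 * l) (β + 2 * k) (i - k - l) x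

/-- Connection coefficient `c_{ih}` of the Bernstein form of the modified Jacobi polynomials. -/
noncomputable def cCoef (α β : ℝ) (n k l i h : ℕ) : ℝ :=
  poch (α + 2 * l + 1) (i - k - l) / (Nat.factorial (i - k - l) : ℝ) *
    (n.choose h : ℝ)⁻¹ * ((n - k - l).choose (h - k) : ℝ) *
    hahnQ (i - k - l) ((n : ℝ) - l - h) (α + 2 * l) (β + 2 * k) (n - k - l)

/-- The quantity `z_{hi}`. -/
noncomputable def zCoef (α β : ℝ) (n k l h i : ℕ) : ℝ :=
  (n.choose h : ℝ) * (2 * (i : ℝ) + (α + β + 1)) * poch ((k : ℝ) + l - n) (i - k - l) *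
      poch (α + 2 * l + 1) (n - l - h) * poch (β + 2 * k + 1) (h - k) /
    (poch (α + 2 * l + 1) (i - k - l) * poch ((i : ℝ) + k + l + (α + β + 1)) (n + 1 - k - l))

/-- The quantity `w_{hi}`. -/
noncomputable def wCoef (α β : ℝ) (n k l h i : ℕ) : ℝ :=
  hahnQ (i - k - l) ((h : ℝ) - k) (β + 2 * k) (α + 2 * l) (n - k - l)

/-- Connection coefficient `d_{hi}` of the modified Jacobi form of Bernstein polynomials. -/
noncomputable def dCoef (α β : ℝ) (n k l h i : ℕ) : ℝ := zCoef α β n k l h i * wCoef α β n k l h i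

/-- Coefficient `a_{ih}^(m,a,b) = (-1)^i ((b+1)_i / i!) Q_i(h; b, a, m)`. -/
noncomputable def aCoef (m : ℕ) (a b : ℝ) (i h : ℕ) : ℝ :=
  (-1 : ℝ) ^ i * poch (b + 1) i / (Nat.factorial i : ℝ) * hahnQ i (h : ℝ) b a m

/-- Coefficient `b_{hi}^(m,a,b)`. -/
noncomputable def bCoef (m : ℕ) (a b : ℝ) (h i : ℕ) : ℝ :=
  (m.choose h : ℝ) * (2 * (i : ℝ) + a + b + 1) * poch (-(m : ℝ)) i * poch (a + 1) (m - h) *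
      poch (b + 1) h / (poch (a + 1) i * poch ((i : ℝ) + a + b + 1) (m + 1)) *
    hahnQ i (h : ℝ) b a m

/-- The quantity `M(i)` of Theorem 3.3. -/
noncomputable def Mfun (α β : ℝ) (n k l i : ℕ) : ℝ :=
  ((i : ℝ) - k - l - 1) * ((n : ℝ) + i + α + β) * ((i : ℝ) + k + β - l - 1) *
      (2 * (i : ℝ) + α + β) /
    ((2 * (i : ℝ) + α + β - 2) * ((i : ℝ) + k + l + α + β) * ((i : ℝ) + l + α - k) *
      ((i : ℝ) - n - 1))

/-- The quantity `K_h(i)` of Theorem 3.3. -/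
noncomputable def Kfun (α β : ℝ) (n k l h i : ℕ) : ℝ :=
  (α + (l : ℝ) + i - k) / ((i : ℝ) - k - l) *
    (1 - Mfun α β n k l i -
      ((l : ℝ) + h - n) * poch (2 * (i : ℝ) + α + β - 1) 2 /
        (((i : ℝ) + k + l + α + β) * (α + (l : ℝ) + i - k) * ((i : ℝ) - n - 1)))

/-- The quantity `L(i)` of Theorem 3.3. -/
noncomputable def Lfun (α β : ℝ) (n k l i : ℕ) : ℝ :=
  poch (α + (l : ℝ) + i - k - 1) 2 / poch ((i : ℝ) - k - l - 1) 2 * Mfun α β n k l i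

lemma poch_zero (x : ℝ) : poch x 0 = 1 := by simp [poch]

lemma poch_succ (x : ℝ) (j : ℕ) : poch x (j + 1) = poch x j * (x + j) := by
  simp [poch, Finset.prod_range_succ]

lemma poch_succ_left (x : ℝ) (j : ℕ) : poch x (j + 1) = x * poch (x + 1) j := by
  simp only [poch, Finset.prod_range_succ']
  rw [mul_comm]
  congr 1
  · simp
  · exact Finset.prod_congr rfl fun i _ => by push_cast; ring

lemma poch_neg_natCast_eq_zero {m j : ℕ} (h : m < j) : poch (-(m : ℝ)) j = 0 :=
  Finset.prod_eq_zero (Finset.mem_range.mpr h) (by simp)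

/-- The part of the Hahn summand that depends on the degree, for a real degree `x`. -/
noncomputable def hahnNumerator (s x : ℝ) (j : ℕ) : ℝ := poch (-x) j * poch (x + s) j

/-- The part of the Hahn summand that does not depend on the degree. -/
noncomputable def hahnWeight (t a : ℝ) (N : ℕ) (j : ℕ) : ℝ :=
  poch (-t) j / ((Nat.factorial j : ℝ) * poch (a + 1) j * poch (-(N : ℝ)) j)

/-- The Hahn sum may be extended beyond its degree. -/
lemma hahnQ_eq_sum_range {m R : ℕ} (hR : m + 1 ≤ R) (t a b : ℝ) (N : ℕ) :
    hahnQ m t a b N =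
      ∑ j ∈ Finset.range R, hahnNumerator (a + b + 1) m j * hahnWeight t a N j := by
  have h : hahnQ m t a b N =
      ∑ j ∈ Finset.range (m + 1), hahnNumerator (a + b + 1) m j * hahnWeight t a N j :=
    Finset.sum_congr rfl fun j _ => by
      simp only [hahnNumerator, hahnWeight, ← add_assoc]
      ring
  rw [h]
  refine Finset.sum_subset (Finset.range_subset_range.mpr hR) fun j _ hj => ?_
  have hmj : m < j := by
    rw [Finset.mem_range, not_lt] at hj
    exact hj
  simp [hahnNumerator, poch_neg_natCast_eq_zero hmj]

lemma hahnWeight_succ {t a : ℝ} (ha : -1 < a) {N j : ℕ} (hj : j < N) :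
    hahnWeight t a N (j + 1) * ((j + 1) * (a + 1 + j) * (j - N)) =
      hahnWeight t a N j * (j - t) := by
  have h1 : a + 1 + j ≠ 0 := by have := j.cast_nonneg (α := ℝ); linarith
  have h2 : -(N : ℝ) + j ≠ 0 := by
    have : (j : ℝ) < N := by exact_mod_cast hj
    linarith
  have h3 : ((j : ℝ) + 1) ≠ 0 := by positivity
  simp only [hahnWeight, poch_succ, Nat.factorial_succ]
  push_cast
  rw [show (j : ℝ) - N = -(N : ℝ) + j by ring]
  simp only [div_eq_mul_inv, mul_inv]
  field_simp
  ring

/-- Three-term relation between the numerators of the Hahn summands. -/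
lemma hahnNumerator_recurrence (a b N x : ℝ) (j : ℕ) :
    (x + a + b) * (x + a) * (N - x + 1) * (2 * x + a + b - 2) *
          hahnNumerator (a + b + 1) x (j + 1)
        - ((x + a + b) * (x + a) * (N - x + 1) * (2 * x + a + b - 2)
            + (x - 1) * (x + a + b + N) * (x - 1 + b) * (2 * x + a + b)
            - (j + 1) * ((2 * x + a + b - 2) * (2 * x + a + b - 1) * (2 * x + a + b))) *
          hahnNumerator (a + b + 1) (x - 1) (j + 1)
        + (x - 1) * (x + a + b + N) * (x - 1 + b) * (2 * x + a + b) *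
          hahnNumerator (a + b + 1) (x - 2) (j + 1) =
      (2 * x + a + b - 2) * (2 * x + a + b - 1) * (2 * x + a + b) *
        ((j + 1) * (a + 1 + j) * (j - N)) * hahnNumerator (a + b + 1) (x - 1) j := by
  cases j with
  | zero =>
    simp only [hahnNumerator, poch_succ, poch_zero]
    push_cast
    ring
  | succ p =>
    have e1 : poch (-x) (p + 2) = -x * ((1 - x) * poch (2 - x) p) := by
      rw [poch_succ_left, poch_succ_left]; ring_nf
    have e2 : poch (-(x - 1)) (p + 2) = (1 - x) * (poch (2 - x) p * (2 - x + p)) := by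
      rw [poch_succ_left, poch_succ]; ring_nf
    have e2' : poch (-(x - 1)) (p + 1) = (1 - x) * poch (2 - x) p := by
      rw [poch_succ_left]; ring_nf
    have e3 : poch (-(x - 2)) (p + 2) = poch (2 - x) p * (2 - x + p) * (3 - x + p) := by
      rw [poch_succ, poch_succ]; push_cast; ring_nf
    have f1 : poch (x + (a + b + 1)) (p + 2) =
        poch (x + (a + b + 1)) p * (x + a + b + 1 + p) * (x + a + b + 2 + p) := by
      rw [poch_succ, poch_succ]; push_cast; ring
    have f2 : poch (x - 1 + (a + b + 1)) (p + 2) =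
        (x + a + b) * (poch (x + (a + b + 1)) p * (x + a + b + 1 + p)) := by
      rw [poch_succ_left, show x - 1 + (a + b + 1) + 1 = x + (a + b + 1) by ring, poch_succ]; ring
    have f2' : poch (x - 1 + (a + b + 1)) (p + 1) =
        (x + a + b) * poch (x + (a + b + 1)) p := by
      rw [poch_succ_left, show x - 1 + (a + b + 1) + 1 = x + (a + b + 1) by ring]; ring
    have f3 : poch (x - 2 + (a + b + 1)) (p + 2) =
        (x + a + b - 1) * ((x + a + b) * poch (x + (a + b + 1)) p) := by
      rw [poch_succ_left, poch_succ_left,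
        show x - 2 + (a + b + 1) + 1 + 1 = x + (a + b + 1) by ring]
      ring
    simp only [hahnNumerator, e1, e2, e2', e3, f1, f2, f2', f3]
    push_cast
    ring

/-- Three-term recurrence of the Hahn polynomials in the degree, with denominators cleared. -/
lemma hahnQ_recurrence {a : ℝ} (ha : -1 < a) (b t : ℝ) {N r : ℕ} (hr : r + 2 ≤ N) {x : ℝ}
    (hx : x = r + 2) :
    (x + a + b) * (x + a) * (N - x + 1) * (2 * x + a + b - 2) * hahnQ (r + 2) t a b N =
      ((x + a + b) * (x + a) * (N - x + 1) * (2 * x + a + b - 2)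
          + (x - 1) * (x + a + b + N) * (x - 1 + b) * (2 * x + a + b)
          - t * ((2 * x + a + b - 2) * (2 * x + a + b - 1) * (2 * x + a + b))) *
        hahnQ (r + 1) t a b N
      - (x - 1) * (x + a + b + N) * (x - 1 + b) * (2 * x + a + b) * hahnQ r t a b N := by
  have c2 : ((r + 2 : ℕ) : ℝ) = x := by rw [hx]; push_cast; ring
  have c1 : ((r + 1 : ℕ) : ℝ) = x - 1 := by rw [hx]; push_cast; ring
  have c0 : (r : ℝ) = x - 2 := by rw [hx]; ring
  have q1 := hahnQ_eq_sum_range (m := r + 1) (R := r + 2) (by omega) t a b N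
  rw [hahnQ_eq_sum_range (m := r + 2) (R := r + 3) (by omega),
    hahnQ_eq_sum_range (m := r) (R := r + 3) (by omega), c2, c0]
  have q1' := hahnQ_eq_sum_range (m := r + 1) (R := r + 3) (by omega) t a b N
  rw [c1] at q1 q1'
  set A := (x + a + b) * (x + a) * (N - x + 1) * (2 * x + a + b - 2)
  set C := (x - 1) * (x + a + b + N) * (x - 1 + b) * (2 * x + a + b)
  set D := (2 * x + a + b - 2) * (2 * x + a + b - 1) * (2 * x + a + b)
  set u := hahnNumerator (a + b + 1)
  set T := hahnWeight t a N
  have key : ∑ j ∈ Finset.range (r + 3),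
      (A * u x j - (A + C - j * D) * u (x - 1) j + C * u (x - 2) j) * T j =
      ∑ j ∈ Finset.range (r + 2), D * (j - t) * u (x - 1) j * T j := by
    rw [Finset.sum_range_succ']
    have h0 : (A * u x 0 - (A + C - (0 : ℕ) * D) * u (x - 1) 0 + C * u (x - 2) 0) * T 0 = 0 := by
      simp [u, hahnNumerator, poch_zero]
    rw [h0, add_zero]
    refine Finset.sum_congr rfl fun j hj => ?_
    have hjN : j < N := by have := Finset.mem_range.mp hj; omega
    have e1 := hahnNumerator_recurrence a b N x j
    have e2 := hahnWeight_succ (t := t) ha hjN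
    push_cast
    linear_combination T (j + 1) * e1 + D * u (x - 1) j * e2
  have tail : ∑ j ∈ Finset.range (r + 3), (j : ℝ) * u (x - 1) j * T j =
      ∑ j ∈ Finset.range (r + 2), (j : ℝ) * u (x - 1) j * T j := by
    rw [Finset.sum_range_succ]
    have : u (x - 1) (r + 2) = 0 := by
      simp only [u, hahnNumerator, ← c1]
      rw [poch_neg_natCast_eq_zero (by omega), zero_mul]
    simp [this]
  have split_left : ∑ j ∈ Finset.range (r + 3),
      (A * u x j - (A + C - j * D) * u (x - 1) j + C * u (x - 2) j) * T j =
      A * (∑ j ∈ Finset.range (r + 3), u x j * T j)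
        - (A + C) * (∑ j ∈ Finset.range (r + 3), u (x - 1) j * T j)
        + D * (∑ j ∈ Finset.range (r + 3), (j : ℝ) * u (x - 1) j * T j)
        + C * (∑ j ∈ Finset.range (r + 3), u (x - 2) j * T j) := by
    simp only [Finset.mul_sum, ← Finset.sum_add_distrib, ← Finset.sum_sub_distrib]
    exact Finset.sum_congr rfl fun j _ => by ring
  have split_right : ∑ j ∈ Finset.range (r + 2), D * (j - t) * u (x - 1) j * T j =
      D * (∑ j ∈ Finset.range (r + 2), (j : ℝ) * u (x - 1) j * T j)
        - t * D * (∑ j ∈ Finset.range (r + 2), u (x - 1) j * T j) := by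
    simp only [Finset.mul_sum, ← Finset.sum_sub_distrib]
    exact Finset.sum_congr rfl fun j _ => by ring
  rw [split_left, split_right, ← q1, ← q1', tail] at key
  linear_combination key

/-- Three-term recurrence of the Hahn polynomials in the degree, solved for the top degree. -/
lemma hahnQ_add_two {a b : ℝ} (ha : -1 < a) (hb : -1 < b) (t : ℝ) {N r : ℕ} (hr : r + 2 ≤ N)
    {x M E : ℝ} (hx : x = r + 2)
    (hM : M = (x - 1) * (x + a + b + N) * (x - 1 + b) * (2 * x + a + b) /
      ((2 * x + a + b - 2) * (x + a + b) * (x + a) * (x - N - 1)))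
    (hE : E = (2 * x + a + b - 1) * (2 * x + a + b) / ((x + a + b) * (x + a) * (x - N - 1))) :
    hahnQ (r + 2) t a b N = (1 - M + t * E) * hahnQ (r + 1) t a b N + M * hahnQ r t a b N := by
  have hrec := hahnQ_recurrence ha b t hr hx
  have hrN : (r : ℝ) + 2 ≤ N := by exact_mod_cast hr
  have hr0 := r.cast_nonneg (α := ℝ)
  have n1 : 2 * x + a + b - 2 ≠ 0 := by linarith
  have n2 : x + a + b ≠ 0 := by linarith
  have n3 : x + a ≠ 0 := by linarith
  have n4 : x - N - 1 ≠ 0 := by linarith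
  rw [eq_div_iff (by simp [n1, n2, n3, n4])] at hM hE
  have n5 : (N : ℝ) - x + 1 ≠ 0 := by linarith
  refine mul_left_cancel₀ (mul_ne_zero (mul_ne_zero (mul_ne_zero n2 n3) n5) n1) ?_
  linear_combination hrec + (hahnQ r t a b N - hahnQ (r + 1) t a b N) * hM +
    t * (2 * x + a + b - 2) * hahnQ (r + 1) t a b N * hE

/-- Recurrence of Theorem 3.3: computing `c_{ih}` for increasing `i`. -/
theorem cCoef_recurrence_in_i (α β : ℝ) (hα : -1 < α) (hβ : -1 < β)
    (n k l : ℕ) (hkl : k + l ≤ n) :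
    ∀ h : ℕ, k ≤ h → h ≤ n - l → ∀ i : ℕ, k + l + 2 ≤ i → i ≤ n →
      cCoef α β n k l i h =
        Kfun α β n k l h i * cCoef α β n k l (i - 1) h +
          Lfun α β n k l i * cCoef α β n k l (i - 2) h := by
  intro h _ _ i hi hin
  obtain ⟨r, rfl⟩ := Nat.exists_eq_add_of_le hi
  obtain ⟨N, rfl⟩ := Nat.exists_eq_add_of_le hkl
  have i0 : k + l + 2 + r - k - l = r + 2 := by omega
  have i1 : k + l + 2 + r - 1 - k - l = r + 1 := by omega
  have i2 : k + l + 2 + r - 2 - k - l = r := by omega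
  have iN : k + l + N - k - l = N := by omega
  have hr := r.cast_nonneg (α := ℝ)
  have hk' := k.cast_nonneg (α := ℝ)
  have hl' := l.cast_nonneg (α := ℝ)
  have hM : Mfun α β (k + l + N) k l (k + l + 2 + r) = _ / _ := rfl
  obtain ⟨E, hE⟩ : ∃ E : ℝ, E = poch (2 * ((k + l + 2 + r : ℕ) : ℝ) + α + β - 1) 2 /
      ((((k + l + 2 + r : ℕ) : ℝ) + k + l + α + β) * (α + l + ((k + l + 2 + r : ℕ) : ℝ) - k) *
        (((k + l + 2 + r : ℕ) : ℝ) - (k + l + N : ℕ) - 1)) := ⟨_, rfl⟩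
  have hrec := hahnQ_add_two (a := α + 2 * l) (b := β + 2 * k) (by linarith) (by linarith)
    (((k + l + N : ℕ) : ℝ) - l - h) (N := N) (r := r) (by omega) (x := r + 2)
    (M := Mfun α β (k + l + N) k l (k + l + 2 + r)) (E := E) rfl
    (by rw [hM]; push_cast; congr 1 <;> ring)
    (by
      rw [hE]
      simp only [poch_succ, poch_zero]
      push_cast
      congr 1 <;> ring)
  simp only [cCoef, i0, i1, i2, iN, Kfun, Lfun, mul_div_assoc, ← hE, hrec]
  generalize Mfun α β (k + l + N) k l (k + l + 2 + r) = M
  simp only [poch_succ, poch_zero, Nat.factorial_succ]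
  have e1 : α + l + ((k + l + 2 + r : ℕ) : ℝ) - k = α + 2 * l + 2 + r := by push_cast; ring
  have e2 : ((k + l + 2 + r : ℕ) : ℝ) - k - l = r + 2 := by push_cast; ring
  simp only [e1, e2]
  have n1 : (r : ℝ) + 1 ≠ 0 := by positivity
  have n2 : (r : ℝ) + 2 ≠ 0 := by positivity
  have n3 : (r.factorial : ℝ) ≠ 0 := by positivity
  have e3 : (r : ℝ) + 2 - 1 = r + 1 := by ring
  have e4 : (r : ℝ) + 1 + 1 = r + 2 := by ring
  push_cast
  simp only [e3, e4, add_zero]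
  generalize hahnQ (r + 1) _ _ _ N = q1
  generalize hahnQ r _ _ _ N = q0
  generalize poch (α + 2 * l + 1) r = P
  generalize (((k + l + N).choose h : ℕ) : ℝ)⁻¹ = B
  generalize ((N.choose (h - k) : ℕ) : ℝ) = B'
  clear hrec hM hE
  field_simp
  ring
end

section
/- Let α and β both be negative integers with -α-β ≤ n. Then for every i with -α-β ≤ i ≤ n and all real x, the generalized Jacobi polynomial Ĵ_i^{(α,β)}(x) := (1-x)^{-α} x^{-β} R_{i+α+β}^{(-α,-β)}(x) satisfies Ĵ_i^{(α,β)}(x) = Σ_{h=-β}^{n+α} C(n,h)^{-1} C(n+α+β, h+β) a_{i+α+β, h+β}^{(n+α+β, -α, -β)} B_h^n(x). -/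
open Finset

lemma poch_neg_natCast (h j : ℕ) : poch (-(h : ℝ)) j = (-1) ^ j * (h.descFactorial j : ℝ) := by
  induction j with
  | zero => simp [poch]
  | succ j ih =>
    rw [poch, prod_range_succ, ← poch, ih, Nat.descFactorial_succ]
    rcases le_or_gt j h with hj | hj
    · push_cast [Nat.cast_sub hj]
      ring
    · simp [Nat.descFactorial_of_lt hj]

lemma poch_natCast_add_one (a i : ℕ) : poch ((a : ℝ) + 1) i * (a.factorial : ℝ) =
    ((a + i).factorial : ℝ) := by
  induction i with
  | zero => simp [poch]
  | succ i ih =>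
    rw [poch, prod_range_succ, ← poch, mul_right_comm, ih, ← add_assoc, Nat.factorial_succ]
    push_cast
    ring

/-- Integer form of the hypergeometric coefficients of a Jacobi polynomial. -/
lemma jacobi_coeff_eq_choose (a b i j : ℕ) (hj : j ≤ i) :
    poch ((a : ℝ) + 1) i / (i.factorial : ℝ) *
      (poch (-(i : ℝ)) j * poch ((i : ℝ) + a + b + 1) j /
        ((j.factorial : ℝ) * poch ((a : ℝ) + 1) j)) =
      (-1) ^ j * ((i + a).choose (i - j) : ℝ) * ((i + j + a + b).choose j : ℝ) := by
  have fac_ne : ∀ k : ℕ, (k.factorial : ℝ) ≠ 0 := fun k => by positivity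
  have h1 : poch ((a : ℝ) + 1) i = ((a + i).factorial : ℝ) / (a.factorial : ℝ) :=
    eq_div_of_mul_eq (fac_ne a) (poch_natCast_add_one a i)
  have h2 : poch ((a : ℝ) + 1) j = ((a + j).factorial : ℝ) / (a.factorial : ℝ) :=
    eq_div_of_mul_eq (fac_ne a) (poch_natCast_add_one a j)
  have h3 : poch ((i : ℝ) + a + b + 1) j =
      ((i + a + b + j).factorial : ℝ) / ((i + a + b).factorial : ℝ) := by
    refine eq_div_of_mul_eq (fac_ne _) ?_
    simpa using poch_natCast_add_one (i + a + b) j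
  have h4 : (i.descFactorial j : ℝ) = (i.factorial : ℝ) / ((i - j).factorial : ℝ) := by
    refine eq_div_of_mul_eq (fac_ne _) ?_
    rw [mul_comm]
    exact_mod_cast Nat.factorial_mul_descFactorial hj
  rw [poch_neg_natCast, h1, h2, h3, h4, Nat.cast_choose ℝ (by omega : i - j ≤ i + a),
    Nat.cast_choose ℝ (by omega : j ≤ i + j + a + b),
    show i + a - (i - j) = a + j by omega, show i + j + a + b - j = i + a + b by omega,
    show i + j + a + b = i + a + b + j by omega, add_comm i a]
  field_simp [fac_ne]

lemma shiftedJacobi_natCast (a b i : ℕ) (x : ℝ) :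
    shiftedJacobi a b i x = ∑ j ∈ range (i + 1),
      ((i + a).choose (i - j) : ℝ) * ((i + j + a + b).choose j : ℝ) * (x - 1) ^ j := by
  rw [shiftedJacobi, mul_sum]
  refine sum_congr rfl fun j hj => ?_
  rw [← mul_assoc, jacobi_coeff_eq_choose a b i j (by simpa [Nat.lt_succ_iff] using hj),
    show x - 1 = -1 * (1 - x) by ring, mul_pow]
  ring

lemma sum_choose_mul_choose_mul_choose (i a b q : ℕ) (hq : q ≤ i) :
    ∑ k ∈ range (i + 1), (i + a).choose k * (i + b).choose (i - k) * k.choose q =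
      (i + a).choose q * (i + (i - q) + a + b).choose (i - q) := by
  obtain ⟨r, rfl⟩ := Nat.exists_eq_add_of_le hq
  rw [add_assoc q r 1, sum_range_add, sum_eq_zero (s := range q), zero_add,
    show q + r + (q + r - q) + a + b = (r + a) + (q + r + b) by omega,
    Nat.add_choose_eq (r + a),
    Nat.sum_antidiagonal_eq_sum_range_succ
      (fun u v => (r + a).choose u * (q + r + b).choose v), mul_sum,
    Nat.add_sub_cancel_left]
  · refine sum_congr rfl fun k hk => ?_
    rw [mem_range] at hk
    have := Nat.choose_mul (n := q + r + a) (k := q + k) (s := q) (by omega)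
    rw [show q + r + a - q = r + a by omega, Nat.add_sub_cancel_left] at this
    rw [mul_right_comm, this, Nat.add_sub_add_left, mul_assoc]
  · intro k hk
    simp [Nat.choose_eq_zero_of_lt (mem_range.1 hk)]

/-- The explicit form of Jacobi polynomials that is symmetric in both endpoints. -/
lemma shiftedJacobi_natCast_eq_symm (a b i : ℕ) (x : ℝ) :
    shiftedJacobi a b i x = ∑ k ∈ range (i + 1),
      ((i + a).choose k : ℝ) * ((i + b).choose (i - k) : ℝ) * x ^ k * (x - 1) ^ (i - k) := by
  have expand : ∀ k ∈ range (i + 1), x ^ k * (x - 1) ^ (i - k) =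
      ∑ q ∈ range (i + 1), (k.choose q : ℝ) * (x - 1) ^ (i - q) := by
    intro k hk
    rw [mem_range] at hk
    have hx : x ^ k = ∑ q ∈ range (k + 1), (k.choose q : ℝ) * (x - 1) ^ (k - q) := by
      conv_lhs => rw [show x = 1 + (x - 1) by ring, add_pow]
      exact sum_congr rfl fun q _ => by rw [one_pow]; ring
    rw [hx, sum_mul]
    refine sum_subset_zero_on_sdiff (range_subset_range.2 (by omega)) ?_ ?_
    · intro q hq
      simp only [mem_sdiff, mem_range] at hq
      simp [Nat.choose_eq_zero_of_lt (show k < q by omega)]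
    · intro q hq
      rw [mem_range] at hq
      rw [mul_assoc, ← pow_add, show k - q + (i - k) = i - q by omega]
  rw [shiftedJacobi_natCast, ← sum_range_reflect]
  simp only [mul_assoc]
  have hsum : ∑ k ∈ range (i + 1), ((i + a).choose k : ℝ) *
      (((i + b).choose (i - k) : ℝ) * (x ^ k * (x - 1) ^ (i - k))) =
      ∑ k ∈ range (i + 1), ((i + a).choose k : ℝ) * (((i + b).choose (i - k) : ℝ) *
        ∑ q ∈ range (i + 1), (k.choose q : ℝ) * (x - 1) ^ (i - q)) :=
    sum_congr rfl fun k hk => by rw [expand k hk]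
  rw [hsum]
  simp only [mul_sum]
  rw [sum_comm]
  refine sum_congr rfl fun q hq => ?_
  have hqi : q ≤ i := by simpa [Nat.lt_succ_iff] using hq
  rw [show i + 1 - 1 - q = i - q by omega, show i - (i - q) = q by omega, ← mul_assoc]
  have key : (((i + a).choose q : ℝ) * ((i + (i - q) + a + b).choose (i - q) : ℝ)) =
      ∑ k ∈ range (i + 1), ((i + a).choose k : ℝ) * ((i + b).choose (i - k) : ℝ) *
        (k.choose q : ℝ) := by
    exact_mod_cast (sum_choose_mul_choose_mul_choose i a b q hqi).symm
  rw [key, sum_mul]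
  exact sum_congr rfl fun k _ => by ring

lemma shiftedJacobi_natCast_one_sub (a b i : ℕ) (x : ℝ) :
    shiftedJacobi a b i x = (-1) ^ i * shiftedJacobi b a i (1 - x) := by
  rw [shiftedJacobi_natCast_eq_symm, shiftedJacobi_natCast_eq_symm, ← sum_range_reflect, mul_sum]
  refine sum_congr rfl fun k hk => ?_
  have hki : k ≤ i := by simpa [Nat.lt_succ_iff] using hk
  rw [show i + 1 - 1 - k = i - k by omega, show i - (i - k) = k by omega,
    show x - 1 = -1 * (1 - x) by ring, show 1 - x - 1 = -1 * x by ring, mul_pow, mul_pow]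
  obtain ⟨r, rfl⟩ := Nat.exists_eq_add_of_le hki
  have hsq : ((-1 : ℝ) ^ r) * (-1) ^ r = 1 := by rw [← mul_pow]; simp
  rw [Nat.add_sub_cancel_left, pow_add]
  linear_combination (-((-1) ^ k * ((k + r + b).choose k : ℝ) * ((k + r + a).choose r : ℝ) *
    (1 - x) ^ k * x ^ r)) * hsq

lemma choose_mul_descFactorial_add (j r k : ℕ) :
    (j + r).choose (j + k) * (j + k).descFactorial j = (j + r).descFactorial j * r.choose k := by
  rcases le_or_gt k r with hk | hk
  · have := Nat.choose_mul (n := j + r) (k := j + k) (s := j) (by omega)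
    rw [Nat.add_sub_cancel_left, Nat.add_sub_cancel_left] at this
    rw [Nat.descFactorial_eq_factorial_mul_choose, Nat.descFactorial_eq_factorial_mul_choose,
      mul_left_comm, this, mul_assoc]
  · simp [Nat.choose_eq_zero_of_lt hk, Nat.choose_eq_zero_of_lt (show j + r < j + k by omega)]

/-- Bernstein form of a monomial. -/
lemma pow_eq_sum_bern (m j : ℕ) (hj : j ≤ m) (x : ℝ) :
    x ^ j = ∑ h ∈ range (m + 1), poch (-(h : ℝ)) j / poch (-(m : ℝ)) j * bern m h x := by
  obtain ⟨r, rfl⟩ := Nat.exists_eq_add_of_le hj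
  have hne : ((j + r).descFactorial j : ℝ) ≠ 0 := by
    exact_mod_cast (Nat.descFactorial_pos.2 hj).ne'
  have hone : ((-1 : ℝ) ^ j) ≠ 0 := by simp
  rw [add_assoc j r 1, sum_range_add, sum_eq_zero (s := range j), zero_add]
  · have hsum : (1 : ℝ) = ∑ k ∈ range (r + 1), x ^ k * (1 - x) ^ (r - k) * (r.choose k : ℝ) := by
      rw [← add_pow]; simp
    conv_lhs => rw [← mul_one (x ^ j), hsum, mul_sum]
    refine sum_congr rfl fun k _ => ?_
    have hc : ((j + r).choose (j + k) : ℝ) * ((j + k).descFactorial j : ℝ) =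
        ((j + r).descFactorial j : ℝ) * (r.choose k : ℝ) := by
      exact_mod_cast choose_mul_descFactorial_add j r k
    rw [poch_neg_natCast, poch_neg_natCast, bern, Nat.add_sub_add_left, mul_div_mul_left _ _ hone,
      pow_add]
    field_simp
    linear_combination (-x ^ j * x ^ k * (1 - x) ^ (r - k)) * hc
  · intro h hh
    rw [poch_neg_natCast, Nat.descFactorial_of_lt (mem_range.1 hh)]
    simp

/-- Bernstein form of the shifted Jacobi polynomials. -/
lemma shiftedJacobi_natCast_eq_sum_bern (a b m i : ℕ) (hi : i ≤ m) (x : ℝ) :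
    shiftedJacobi a b i x = ∑ h ∈ range (m + 1), aCoef m a b i h * bern m h x := by
  rw [shiftedJacobi_natCast_one_sub, shiftedJacobi]
  simp only [aCoef, hahnQ, mul_sum, sum_mul]
  rw [sum_comm]
  refine sum_congr rfl fun j hj => ?_
  have hjm : j ≤ m := by rw [mem_range] at hj; omega
  rw [sub_sub_cancel, pow_eq_sum_bern m j hjm x]
  simp only [mul_sum]
  refine sum_congr rfl fun h _ => ?_
  simp only [div_eq_mul_inv, mul_inv]
  ring

/-- Generalized Jacobi polynomials, case `α, β ∈ ℤ⁻`: Bernstein form. -/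
theorem genJacobi_bernstein_form_neg_both (n : ℕ) (α β : ℤ) (hα : α < 0) (hβ : β < 0)
    (hαβn : -α - β ≤ (n : ℤ)) :
    ∀ i : ℕ, -α - β ≤ (i : ℤ) → i ≤ n → ∀ x : ℝ,
      (1 - x) ^ (-α).toNat * x ^ (-β).toNat *
          shiftedJacobi ((-α : ℤ) : ℝ) ((-β : ℤ) : ℝ) ((i : ℤ) + α + β).toNat x =
        ∑ h ∈ Finset.Icc (-β).toNat ((n : ℤ) + α).toNat,
          (n.choose h : ℝ)⁻¹ *
            (((n : ℤ) + α + β).toNat.choose ((h : ℤ) + β).toNat : ℝ) *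
            aCoef ((n : ℤ) + α + β).toNat ((-α : ℤ) : ℝ) ((-β : ℤ) : ℝ)
              ((i : ℤ) + α + β).toNat ((h : ℤ) + β).toNat * bern n h x := by
  obtain ⟨a, rfl⟩ : ∃ a : ℕ, α = -(a : ℤ) := ⟨(-α).toNat, by omega⟩
  obtain ⟨b, rfl⟩ : ∃ b : ℕ, β = -(b : ℤ) := ⟨(-β).toNat, by omega⟩
  obtain ⟨m, rfl⟩ : ∃ m : ℕ, n = b + m + a := ⟨n - a - b, by omega⟩
  intro i hi hin x
  obtain ⟨l, rfl⟩ : ∃ l : ℕ, i = b + l + a := ⟨i - a - b, by omega⟩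
  rw [show (-(-(a : ℤ))).toNat = a by omega, show (-(-(b : ℤ))).toNat = b by omega,
    show (((b + l + a : ℕ) : ℤ) + -(a : ℤ) + -(b : ℤ)).toNat = l by omega,
    show (((b + m + a : ℕ) : ℤ) + -(a : ℤ)).toNat = b + m by omega,
    show (((b + m + a : ℕ) : ℤ) + -(a : ℤ) + -(b : ℤ)).toNat = m by omega]
  simp only [neg_neg, Int.cast_natCast]
  rw [shiftedJacobi_natCast_eq_sum_bern a b m l (by omega) x, mul_sum,
    ← Ico_add_one_right_eq_Icc, sum_Ico_eq_sum_range, show b + m + 1 - b = m + 1 by omega]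
  refine sum_congr rfl fun h hh => ?_
  rw [mem_range] at hh
  have hne : ((b + m + a).choose (b + h) : ℝ) ≠ 0 := by
    exact_mod_cast (Nat.choose_pos (by omega)).ne'
  rw [show (((b + h : ℕ) : ℤ) + -(b : ℤ)).toNat = h by omega, bern, bern,
    show b + m + a - (b + h) = m - h + a by omega, pow_add, pow_add]
  field_simp
end
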